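/- arXiv:2201.04860 — 3 statements merged into one kernel-verified Lean document; each statement's English description precedes it below -/
import Mathlib

section
/- Let p be a prime and let G be a finite p-group possessing a cyclic maximal subgroup (i.e., a cyclic subgroup of index p). Then for every word w in k variables and every g in the image G_w of the word map, P_{w,G}(g) ≥ 1/|G|; equivalently, N_{w,G}(g)·|G| ≥ |G|^k. -/
/-- The integer combinations of the functions `c ↦ r ^ ∑ i, s i * c i` on `(ℤ/p)^k`, where residues
are represented by the integers in `[0, p)`. -/
def powerSums (p : ℕ) (r : ℤ) (k : ℕ) : AddSubgroup ((Fin k → ZMod p) → ℤ) :=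
  AddSubgroup.closure (Set.range fun (s : Fin k → ℕ) c => r ^ ∑ i, s i * (c i).val)

open Classical in
/-- The largest `m ≤ v` such that `p ^ m` divides every entry of `x`. -/
noncomputable def depth {ι : Type*} (p v : ℕ) (x : ι → ℤ) : ℕ :=
  Nat.findGreatest (fun m => ∀ i, (p : ℤ) ^ m ∣ x i) v

theorem depth_le {ι : Type*} (p v : ℕ) (x : ι → ℤ) : depth p v x ≤ v := by
  classical
  exact Nat.findGreatest_le v

theorem pow_depth_dvd {ι : Type*} (p v : ℕ) (x : ι → ℤ) (i : ι) : (p : ℤ) ^ depth p v x ∣ x i := by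
  classical
  exact Nat.findGreatest_spec (P := fun m => ∀ i, (p : ℤ) ^ m ∣ x i) (Nat.zero_le v) (by simp) i

theorem le_depth {ι : Type*} {p v m : ℕ} {x : ι → ℤ} (hm : m ≤ v) (h : ∀ i, (p : ℤ) ^ m ∣ x i) :
    m ≤ depth p v x := by
  classical
  exact Nat.le_findGreatest hm h

section powerSums

variable {p : ℕ} {r : ℤ} {k : ℕ}

theorem powerSums_monomial (s : Fin k → ℕ) :
    (fun c => r ^ ∑ i, s i * (c i).val) ∈ powerSums p r k :=
  AddSubgroup.subset_closure ⟨s, rfl⟩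

theorem powerSums_monomial_mul (s : Fin k → ℕ) {f : (Fin k → ZMod p) → ℤ}
    (hf : f ∈ powerSums p r k) :
    (fun c => r ^ (∑ i, s i * (c i).val) * f c) ∈ powerSums p r k := by
  induction hf using AddSubgroup.closure_induction with
  | mem f hf =>
    obtain ⟨t, rfl⟩ := hf
    convert powerSums_monomial (p := p) (r := r) (s + t) using 2 with c
    simp [add_mul, Finset.sum_add_distrib, pow_add]
  | zero =>
    convert zero_mem (powerSums p r k) using 1
    ext c
    simp
  | add f g _ _ hf hg =>
    convert add_mem hf hg using 1
    ext c
    simp [mul_add]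
  | neg f _ hf =>
    convert neg_mem hf using 1
    ext c
    simp

theorem powerSums_modEq (hr : (p : ℤ) ∣ r - 1) {f : (Fin k → ZMod p) → ℤ}
    (hf : f ∈ powerSums p r k) (c d : Fin k → ZMod p) : (p : ℤ) ∣ f c - f d := by
  induction hf using AddSubgroup.closure_induction with
  | mem f hf =>
    obtain ⟨t, rfl⟩ := hf
    have h (n : ℕ) : (p : ℤ) ∣ r ^ n - 1 := hr.trans (sub_one_dvd_pow_sub_one r n)
    simpa using (h (∑ i, t i * (c i).val)).sub (h (∑ i, t i * (d i).val))
  | zero => simp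
  | add f g _ _ hf hg =>
    simpa only [Pi.add_apply, add_sub_add_comm] using hf.add hg
  | neg f _ hf =>
    rw [Pi.neg_apply, Pi.neg_apply, neg_sub_neg]
    exact (dvd_sub_comm).1 hf

theorem powerSums_cons_sub_cons (hr : (p : ℤ) ∣ r - 1) {f : (Fin (k + 1) → ZMod p) → ℤ}
    (hf : f ∈ powerSums p r (k + 1)) (a b : ZMod p) :
    ∃ g ∈ powerSums p r k, ∀ c, f (Fin.cons a c) - f (Fin.cons b c) = p * g c := by
  induction hf using AddSubgroup.closure_induction with
  | mem f hf =>
    obtain ⟨t, rfl⟩ := hf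
    have h (n : ℕ) : (p : ℤ) ∣ r ^ n - 1 := hr.trans (sub_one_dvd_pow_sub_one r n)
    obtain ⟨m, hm⟩ := (h (t 0 * a.val)).sub (h (t 0 * b.val))
    refine ⟨_, zsmul_mem (powerSums_monomial fun i => t i.succ) m, fun c => ?_⟩
    simp only [Fin.sum_univ_succ, Fin.cons_zero, Fin.cons_succ, pow_add, Pi.smul_apply, smul_eq_mul]
    linear_combination r ^ (∑ i : Fin k, t i.succ * (c i).val) * hm
  | zero => exact ⟨0, zero_mem _, by simp⟩
  | add f g _ _ hf hg =>
    obtain ⟨f', hf', hf⟩ := hf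
    obtain ⟨g', hg', hg⟩ := hg
    refine ⟨_, add_mem hf' hg', fun c => ?_⟩
    simp only [Pi.add_apply]
    linear_combination hf c + hg c
  | neg f _ hf =>
    obtain ⟨f', hf', hf⟩ := hf
    refine ⟨_, neg_mem hf', fun c => ?_⟩
    simp only [Pi.neg_apply]
    linear_combination - hf c

theorem powerSums_cons {f : (Fin (k + 1) → ZMod p) → ℤ}
    (hf : f ∈ powerSums p r (k + 1)) (a : ZMod p) :
    (fun c => f (Fin.cons a c)) ∈ powerSums p r k := by
  induction hf using AddSubgroup.closure_induction with
  | mem f hf =>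
    obtain ⟨t, rfl⟩ := hf
    convert zsmul_mem (powerSums_monomial (p := p) (r := r) fun i => t i.succ) (r ^ (t 0 * a.val))
      using 1
    ext c
    simp [Fin.sum_univ_succ, pow_add]
  | zero => exact zero_mem (powerSums p r k)
  | add f g _ _ hf hg => exact add_mem hf hg
  | neg f _ hf => exact neg_mem hf

open Classical in
theorem pow_le_sum_pow_depth (hp : p.Prime) [NeZero p] (hr : (p : ℤ) ∣ r - 1) {ι : Type*}
    {f : ι → (Fin k → ZMod p) → ℤ} (hf : ∀ i, f i ∈ powerSums p r k) {v : ℕ} {c₀ : Fin k → ZMod p}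
    (hc₀ : ¬ ∀ i, (p : ℤ) ^ (v + 1) ∣ f i c₀) :
    p ^ k ≤ ∑ c with ¬ ∀ i, (p : ℤ) ^ (v + 1) ∣ f i c, p ^ depth p v (fun i => f i c) := by
  induction k generalizing v with
  | zero =>
    refine le_trans ?_ (Finset.single_le_sum (fun _ _ => Nat.zero_le _) (a := c₀)
      (Finset.mem_filter.2 ⟨Finset.mem_univ _, hc₀⟩))
    simpa using Nat.one_le_pow _ _ hp.pos
  | succ k ih =>
    rw [Finset.sum_filter, ← (Fin.consEquiv fun _ => ZMod p).sum_comp, Fintype.sum_prod_type]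
    have hcons (a c) : Fin.consEquiv (fun _ : Fin (k + 1) => ZMod p) (a, c) = Fin.cons a c := rfl
    simp only [hcons, ← Finset.sum_filter]
    by_cases h : ∀ a, ∃ c, ¬ ∀ i, (p : ℤ) ^ (v + 1) ∣ f i (Fin.cons a c)
    · calc p ^ (k + 1) = ∑ _a : ZMod p, p ^ k := by simp [ZMod.card, pow_succ']
        _ ≤ _ := Finset.sum_le_sum fun a _ => by
          obtain ⟨c, hc⟩ := h a
          exact ih (fun i => powerSums_cons (hf i) a) hc
    · push Not at h
      obtain ⟨b, hb⟩ := h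
      obtain ⟨a, c₀, rfl⟩ : ∃ a c, c₀ = Fin.cons a c := ⟨_, _, (Fin.cons_self_tail c₀).symm⟩
      choose g hg hfg using fun i => powerSums_cons_sub_cons hr (hf i) a b
      have hp0 : (p : ℤ) ≠ 0 := by exact_mod_cast hp.ne_zero
      have key (m : ℕ) (hm : m ≤ v) (i c) :
          (p : ℤ) ^ (m + 1) ∣ f i (Fin.cons a c) ↔ (p : ℤ) ^ m ∣ g i c := by
        rw [← dvd_sub_left ((pow_dvd_pow _ (by lia)).trans (hb c i)), hfg, pow_succ',
          mul_dvd_mul_iff_left hp0]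
      obtain _ | v := v
      · exact absurd (fun i => (key 0 le_rfl i c₀).2 (by simp)) hc₀
      refine le_trans ?_ (Finset.single_le_sum (fun _ _ => Nat.zero_le _) (Finset.mem_univ a))
      simp only [key (v + 1) le_rfl] at hc₀ ⊢
      rw [pow_succ']
      refine (Nat.mul_le_mul_left p (ih hg hc₀)).trans ?_
      rw [Finset.mul_sum]
      refine Finset.sum_le_sum fun c _ => ?_
      rw [← pow_succ']
      refine Nat.pow_le_pow_right hp.pos (le_depth (by simpa using depth_le _ _ _) fun i => ?_)
      exact (key _ ((depth_le _ _ _).trans (by lia)) i c).2 (pow_depth_dvd p v (fun i => g i c) i)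

end powerSums

theorem card_le_card_linear_fiber_mul {N d : ℕ} [NeZero N] (hd : d ∣ N) {k : ℕ} (D : Fin k → ℤ)
    (hD : ∀ i, (d : ℤ) ∣ D i) (u₀ : Fin k → ZMod N) :
    N ^ k * d ≤ Nat.card {u : Fin k → ZMod N // ∑ i, D i * u i = ∑ i, D i * u₀ i} * N := by
  let φ : (Fin k → ZMod N) →+ ZMod N :=
    { toFun u := ∑ i, D i * u i
      map_zero' := by simp
      map_add' u v := by simp [mul_add, Finset.sum_add_distrib] }
  obtain ⟨m, rfl⟩ := hd
  have hm : 0 < m := Nat.pos_of_ne_zero (right_ne_zero_of_mul (NeZero.ne (d * m)))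
  have hfiber : Nat.card {u : Fin k → ZMod (d * m) // ∑ i, D i * u i = ∑ i, D i * u₀ i} =
      Nat.card φ.ker := by
    classical
    have := AddMonoidHom.card_fiber_eq_of_mem_range φ (x := φ u₀) (y := 0) ⟨u₀, rfl⟩ ⟨0, map_zero φ⟩
    simpa [← Fintype.card_subtype, Nat.card_eq_fintype_card, AddMonoidHom.mem_ker] using! this
  have hrange : Nat.card φ.range ≤ m := by
    classical
    calc Nat.card φ.range ≤ Nat.card {x : ZMod (d * m) // m • x = 0} := by
          refine Nat.card_le_card_of_injective
            (Subtype.map id ?_) (Subtype.map_injective _ Function.injective_id)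
          rintro _ ⟨u, rfl⟩
          simp only [φ, id, AddMonoidHom.coe_mk, ZeroHom.coe_mk, Finset.smul_sum]
          refine Finset.sum_eq_zero fun i _ => ?_
          obtain ⟨b, hb⟩ := hD i
          have : ((d * m : ℕ) : ZMod (d * m)) = 0 := ZMod.natCast_self _
          push_cast at this
          rw [hb, nsmul_eq_mul]
          push_cast
          linear_combination b * u i * this
      _ ≤ m := by
          rw [Nat.card_eq_fintype_card, Fintype.card_subtype]
          exact IsAddCyclic.card_nsmul_eq_zero_le hm
  have hcard : Nat.card φ.ker * Nat.card φ.range = (d * m) ^ k := by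
    rw [mul_comm, ← AddSubgroup.index_ker, AddSubgroup.index_mul_card]
    simp
  rw [hfiber, ← hcard]
  calc _ ≤ Nat.card φ.ker * m * d := by gcongr
    _ = _ := by ring

theorem exists_linear_eq {p n v : ℕ} (hp : p.Prime) {k : ℕ} {D : Fin k → ℤ}
    (hD : ¬ ∀ i, (p : ℤ) ^ (v + 1) ∣ D i) {y : ℤ} (hy : (p : ℤ) ^ v ∣ y) :
    ∃ u : Fin k → ℤ, ((p ^ n : ℕ) : ℤ) ∣ y - ∑ i, D i * u i := by
  push Not at hD
  obtain ⟨i, hi⟩ := hD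
  obtain ⟨j, -, hj⟩ := (Nat.dvd_prime_pow hp).1 (Int.gcd_dvd_natAbs_right (D i) (p ^ n : ℕ))
  have hjv : j ≤ v := by
    by_contra! h
    refine hi ((pow_dvd_pow _ h).trans ?_)
    have := Int.gcd_dvd_left (D i) (p ^ n : ℕ)
    rw [hj] at this
    exact_mod_cast this
  obtain ⟨z, rfl⟩ := (pow_dvd_pow (p : ℤ) hjv).trans hy
  refine ⟨Pi.single i (Int.gcdA (D i) (p ^ n : ℕ) * z), ?_⟩
  have hb := Int.gcd_eq_gcd_ab (D i) (p ^ n : ℕ)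
  rw [hj, Nat.cast_pow] at hb
  rw [Finset.sum_eq_single i (fun b _ h => by simp [h]) (by simp), hb, Pi.single_eq_same]
  exact ⟨Int.gcdB (D i) (p ^ n : ℕ) * z, by push_cast; ring⟩

theorem card_pow_le_of_commute {G : Type*} [Group G] [Finite G] (hG : ∀ x y : G, x * y = y * x)
    {k : ℕ} (w : FreeGroup (Fin k)) (v₀ : Fin k → G) :
    Nat.card G ^ k ≤
      Nat.card {v : Fin k → G // FreeGroup.lift v w = FreeGroup.lift v₀ w} * Nat.card G := by
  classical
  let _ : CommGroup G := { mul_comm := hG }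
  have _ := Fintype.ofFinite G
  let φ : (Fin k → G) →* G := MonoidHom.mk' (fun v => FreeGroup.lift v w) fun v v' => by
    have : FreeGroup.lift (v * v') = FreeGroup.lift v * FreeGroup.lift v' := by ext; simp
    exact DFunLike.congr_fun this w
  have hfiber : Nat.card {v : Fin k → G // FreeGroup.lift v w = FreeGroup.lift v₀ w} =
      Nat.card φ.ker := by
    have := MonoidHom.card_fiber_eq_of_mem_range φ (x := φ v₀) (y := 1) ⟨v₀, rfl⟩ ⟨1, map_one φ⟩
    simpa [← Fintype.card_subtype, Nat.card_eq_fintype_card, MonoidHom.mem_ker] using! this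
  have hcard : Nat.card φ.ker * Nat.card φ.range = Nat.card G ^ k := by
    rw [mul_comm, ← Subgroup.index_ker, Subgroup.index_mul_card]
    simp
  rw [hfiber, ← hcard]
  exact Nat.mul_le_mul_left _ (Nat.card_le_card_of_injective _ φ.range.subtype_injective)

theorem mul_zpow_of_conj {G : Type*} [Group G] {x a : G} {r : ℤ} (h : x * a = a ^ r * x)
    (z : ℤ) : x * a ^ z = a ^ (r * z) * x := by
  have : x * a * x⁻¹ = a ^ r := by rw [h, mul_inv_cancel_right]
  rw [zpow_mul, ← this, conj_zpow, inv_mul_cancel_right]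

theorem pow_mul_of_conj {G : Type*} [Group G] {t a : G} {r : ℤ} (h : t * a = a ^ r * t)
    (n : ℕ) : t ^ n * a = a ^ (r ^ n) * t ^ n := by
  induction n with
  | zero => simp
  | succ n ih => rw [pow_succ', mul_assoc, ih, ← mul_assoc, mul_zpow_of_conj h, mul_assoc,
      ← pow_succ', ← pow_succ']

/-- The integers `D i c` play the role of Fox derivatives of `w`, evaluated at the class of
`(t ^ c i)ᵢ`: conjugation by `t` acts on the powers of `a` as multiplication by `r` of exponents. -/
theorem exists_lift_eq_zpow_mul {G : Type*} [Group G] [Finite G] {t a : G} {r : ℤ}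
    (h : t * a = a ^ r * t) (p : ℕ) {k : ℕ} (w : FreeGroup (Fin k)) :
    ∃ D : Fin k → (Fin k → ZMod p) → ℤ, (∀ i, D i ∈ powerSums p r k) ∧
      (∀ c : Fin k → ZMod p,
        FreeGroup.lift (fun i => t ^ (c i).val) w = t ^ ∑ i, D i 0 * (c i).val) ∧
      ∀ (c : Fin k → ZMod p) (u : Fin k → ℤ),
        FreeGroup.lift (fun i => a ^ u i * t ^ (c i).val) w =
          a ^ (∑ i, D i c * u i) * FreeGroup.lift (fun i => t ^ (c i).val) w := by
  suffices H : ∃ D : Fin k → (Fin k → ZMod p) → ℤ, (∀ i, D i ∈ powerSums p r k) ∧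
      (∀ c : Fin k → ZMod p,
        FreeGroup.lift (fun i => t ^ (c i).val) w = t ^ ∑ i, D i 0 * (c i).val) ∧
      (∀ (c : Fin k → ZMod p) (u : Fin k → ℤ),
        FreeGroup.lift (fun i => a ^ u i * t ^ (c i).val) w =
          a ^ (∑ i, D i c * u i) * FreeGroup.lift (fun i => t ^ (c i).val) w) ∧
      ∃ s : Fin k → ℕ, ∀ c : Fin k → ZMod p,
        FreeGroup.lift (fun i => t ^ (c i).val) w * a =
          a ^ (r ^ ∑ i, s i * (c i).val) * FreeGroup.lift (fun i => t ^ (c i).val) w by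
    obtain ⟨D, h₁, h₂, h₃, -⟩ := H
    exact ⟨D, h₁, h₂, h₃⟩
  have hone : (fun _ => 1) ∈ powerSums p r k := by
    simpa using powerSums_monomial (p := p) (r := r) (k := k) 0
  induction w using FreeGroup.induction_on with
  | C1 => exact ⟨0, fun i => zero_mem _, by simp, by simp, 0, by simp⟩
  | of j =>
    refine ⟨fun i c => if i = j then 1 else 0, fun i => ?_, by simp, by simp, Pi.single j 1, ?_⟩
    · by_cases hij : i = j
      · simpa only [hij] using! hone
      · simpa only [hij] using! zero_mem (powerSums p r k)
    · intro c
      rw [Finset.sum_eq_single j (fun b _ h => by simp [h]) (by simp)]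
      simp [pow_mul_of_conj h]
  | inv_of j _ =>
    obtain ⟨m, hm⟩ : ∃ m : ℕ, t⁻¹ = t ^ m :=
      (isOfFinOrder_of_finite t).mem_powers_iff_mem_zpowers.2 (inv_mem (Subgroup.mem_zpowers t))
        |>.imp fun _ h => h.symm
    have hinv (c : Fin k → ZMod p) : (t ^ (c j).val)⁻¹ = t ^ (m * (c j).val) := by
      rw [pow_mul, ← hm, inv_pow]
    refine ⟨fun i c => if i = j then -r ^ (m * (c j).val) else 0, fun i => ?_, ?_, ?_,
      Pi.single j m, ?_⟩
    · by_cases hij : i = j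
      · simp only [hij, if_true]
        convert neg_mem (powerSums_monomial (p := p) (r := r) (Pi.single j m)) using 1
        ext c
        rw [Pi.neg_apply, Finset.sum_eq_single j (fun b _ h => by simp [h]) (by simp)]
        simp
      · simpa only [hij] using! zero_mem (powerSums p r k)
    · simp
    · intro c u
      simp only [map_inv, FreeGroup.lift_apply_of, mul_inv_rev, hinv, ← zpow_neg,
        mul_zpow_of_conj (pow_mul_of_conj h _)]
      simp
    · intro c
      rw [Finset.sum_eq_single j (fun b _ h => by simp [h]) (by simp)]
      simp [hinv, pow_mul_of_conj h]
  | mul w₁ w₂ ih₁ ih₂ =>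
    obtain ⟨D, hD, hE, hF, s, hs⟩ := ih₁
    obtain ⟨D', hD', hE', hF', s', hs'⟩ := ih₂
    refine ⟨fun i => D i + fun c => r ^ (∑ i, s i * (c i).val) * D' i c,
      fun i => add_mem (hD i) (powerSums_monomial_mul s (hD' i)), fun c => ?_, fun c u => ?_,
      s + s', fun c => ?_⟩
    · rw [map_mul, hE, hE', ← zpow_add, ← Finset.sum_add_distrib]
      simp [add_mul]
    · simp only [map_mul, hF, hF', Pi.add_apply, add_mul, Finset.sum_add_distrib, zpow_add, mul_assoc,
        ← Finset.mul_sum]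
      rw [← mul_assoc (FreeGroup.lift _ w₁) (a ^ _), mul_zpow_of_conj (hs c)]
      simp only [mul_assoc]
    · rw [map_mul, mul_assoc, hs', ← mul_assoc, mul_zpow_of_conj (hs c), mul_assoc]
      simp [add_mul, Finset.sum_add_distrib, pow_add]

theorem card_le_card_coset_fiber_mul {G : Type*} [Group G] {a g h : G} [NeZero (orderOf a)] {d : ℕ}
    (hd : d ∣ orderOf a) {k : ℕ} {D : Fin k → ℤ} (hD : ∀ i, (d : ℤ) ∣ D i)
    (hg : ∃ u : Fin k → ℤ, a ^ (∑ i, D i * u i) * h = g) :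
    orderOf a ^ k * d ≤ Nat.card {u : Fin k → ZMod (orderOf a) //
      a ^ (∑ i, D i * ((u i).val : ℤ)) * h = g} * orderOf a := by
  obtain ⟨u₀, rfl⟩ := hg
  convert card_le_card_linear_fiber_mul hd D hD (fun i => (u₀ i : ZMod (orderOf a))) using 6 with u
  rw [mul_left_inj, zpow_eq_zpow_iff_modEq, ← ZMod.intCast_eq_intCast_iff]
  simp

/-- Every element of `G` is uniquely of the form `a ^ u * t ^ c` with `0 ≤ u < orderOf a` and
`0 ≤ c < p`. -/
theorem bijective_zpow_mul_pow {G : Type*} [Group G] [Finite G] {p : ℕ} [Fact p.Prime] {a t : G}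
    [NeZero (orderOf a)] (hn : (Subgroup.zpowers a).Normal) (hi : (Subgroup.zpowers a).index = p)
    (ht : t ∉ Subgroup.zpowers a) :
    Function.Bijective fun x : ZMod p × ZMod (orderOf a) => a ^ (x.2.val : ℤ) * t ^ x.1.val := by
  have _ := Fintype.ofFinite G
  rw [Fintype.bijective_iff_surjective_and_card]
  have htp : t ^ p ∈ Subgroup.zpowers a := hi ▸ Subgroup.pow_index_mem _ t
  constructor
  · intro x
    obtain ⟨z, hz⟩ := Subgroup.mem_zpowers_iff.1 (mem_zpowers_of_prime_card (p := p)
      (g := (t : G ⧸ Subgroup.zpowers a)) (g' := (x : G ⧸ Subgroup.zpowers a)) hi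
      (by simpa using ht))
    have hmem : x * (t ^ (z : ZMod p).val)⁻¹ ∈ Subgroup.zpowers a := by
      rw [← QuotientGroup.eq_one_iff, QuotientGroup.mk_mul, QuotientGroup.mk_inv, ← hz,
        mul_inv_eq_one, QuotientGroup.mk_pow, ← zpow_natCast, ZMod.val_intCast,
        ← zpow_mod_natCard]
      exact congrArg _ (congrArg _ (congrArg _ hi))
    obtain ⟨y, hy⟩ := hmem
    refine ⟨(z, y), ?_⟩
    simp only [ZMod.val_intCast, zpow_mod_orderOf] at hy ⊢
    rw [← eq_mul_inv_iff_mul_eq, ← hy]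
  · rw [Fintype.card_prod, ZMod.card, ZMod.card, ← Nat.card_eq_fintype_card,
      ← Subgroup.index_mul_card (Subgroup.zpowers a), hi, Nat.card_zpowers]

theorem card_lift_fiber_eq_sum {G : Type*} [Group G] [Finite G] {p : ℕ} [Fact p.Prime] {a t : G}
    [NeZero (orderOf a)] (hb : Function.Bijective fun x : ZMod p × ZMod (orderOf a) =>
      a ^ (x.2.val : ℤ) * t ^ x.1.val) {k : ℕ} (w : FreeGroup (Fin k)) (g : G) :
    Nat.card {v : Fin k → G // FreeGroup.lift v w = g} =
      ∑ c : Fin k → ZMod p, Nat.card {u : Fin k → ZMod (orderOf a) //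
        FreeGroup.lift (fun i => a ^ ((u i).val : ℤ) * t ^ (c i).val) w = g} := by
  let e : (Fin k → ZMod p) × (Fin k → ZMod (orderOf a)) ≃ (Fin k → G) :=
    (Equiv.arrowProdEquivProdArrow _ _ _).symm.trans (Equiv.arrowCongr (Equiv.refl _)
      (Equiv.ofBijective _ hb))
  rw [← Nat.card_congr (e.subtypeEquiv fun x => Iff.rfl), ← Nat.card_sigma]
  exact Nat.card_congr (Equiv.subtypeProdEquivSigmaSubtype fun c u => FreeGroup.lift (e (c, u)) w = g)

theorem card_pow_le_of_not_mem_zpowers {G : Type*} [Group G] [Finite G] {p n : ℕ}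
    [Fact p.Prime] {a t : G} (hn : orderOf a = p ^ n) (hA : (Subgroup.zpowers a).Normal)
    (hi : (Subgroup.zpowers a).index = p) (ht : t ∉ Subgroup.zpowers a)
    (ha : a ∉ Subgroup.zpowers t) {k : ℕ} (w : FreeGroup (Fin k)) (v₀ : Fin k → G) :
    Nat.card G ^ k ≤
      Nat.card {v : Fin k → G // FreeGroup.lift v w = FreeGroup.lift v₀ w} * Nat.card G := by
  classical
  have hp : p.Prime := Fact.out
  have _ : NeZero (orderOf a) := ⟨(orderOf_pos a).ne'⟩
  have hpn : (p : ℤ) ∣ (orderOf a : ℤ) := by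
    obtain _ | n := n
    · rw [pow_zero, orderOf_eq_one_iff] at hn
      exact absurd (hn ▸ one_mem _) ha
    · exact hn ▸ ⟨(p : ℤ) ^ n, by push_cast; ring⟩
  obtain ⟨r, hr⟩ : ∃ r : ℤ, t * a = a ^ r * t := by
    obtain ⟨r, hr⟩ := hA.conj_mem a (Subgroup.mem_zpowers a) t
    exact ⟨r, by simp only at hr; rw [hr]; group⟩
  obtain ⟨l, hl⟩ : t ^ p ∈ Subgroup.zpowers a := hi ▸ Subgroup.pow_index_mem _ t
  simp only at hl
  have hr1 : (p : ℤ) ∣ r - 1 := by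
    have h1 : a ^ (r ^ p) = a ^ (1 : ℤ) := by
      have := pow_mul_of_conj hr p
      rw [← hl, ((Commute.refl a).zpow_left l).eq, mul_left_inj] at this
      rw [← this, zpow_one]
    rw [zpow_eq_zpow_iff_modEq] at h1
    have h2 := (ZMod.intCast_eq_intCast_iff _ _ p).2 (h1.of_dvd hpn)
    push_cast at h2
    rw [ZMod.pow_card] at h2
    rw [← ZMod.intCast_zmod_eq_zero_iff_dvd]
    simp [h2]
  obtain ⟨l, rfl⟩ : (p : ℤ) ∣ l := by
    by_contra h
    obtain ⟨x, y, hxy⟩ : IsCoprime l (orderOf a : ℤ) := by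
      rw [hn, Nat.cast_pow]
      exact (((Nat.prime_iff_prime_int.1 hp).coprime_iff_not_dvd.2 h).symm).pow_right
    refine ha ⟨p * x, ?_⟩
    simp only [zpow_mul, zpow_natCast, ← hl]
    rw [← zpow_mul, ← zpow_one a, ← zpow_mul, one_mul, zpow_eq_zpow_iff_modEq]
    exact Int.modEq_iff_dvd.2 ⟨y, by linear_combination -hxy⟩
  obtain ⟨D, hD, hE, hF⟩ := exists_lift_eq_zpow_mul hr p w
  have hb := bijective_zpow_mul_pow hA hi ht
  choose x hx using fun i => hb.2 (v₀ i)
  obtain ⟨c₀, hc₀⟩ : ∃ c₀, c₀ = fun i => (x i).1 := ⟨_, rfl⟩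
  obtain ⟨u₀, hu₀⟩ : ∃ u₀ : Fin k → ℤ, u₀ = fun i => ((x i).2.val : ℤ) := ⟨_, rfl⟩
  obtain rfl : v₀ = fun i => a ^ u₀ i * t ^ (c₀ i).val := by
    ext i
    simp [hc₀, hu₀, ← hx]
  rw [card_lift_fiber_eq_sum hb, ← Subgroup.index_mul_card (Subgroup.zpowers a), hi,
    Nat.card_zpowers]
  have hbound (c : Fin k → ZMod p) (m : ℕ) (hm : m ≤ n) (hd : ∀ i, (p : ℤ) ^ m ∣ D i c)
      (hu : ∃ u : Fin k → ℤ, a ^ (∑ i, D i c * u i) * t ^ (∑ i, D i 0 * ((c i).val : ℤ)) =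
        a ^ (∑ i, D i c₀ * u₀ i) * t ^ (∑ i, D i 0 * ((c₀ i).val : ℤ))) :
      orderOf a ^ k * p ^ m ≤ Nat.card {u : Fin k → ZMod (orderOf a) //
        FreeGroup.lift (fun i => a ^ ((u i).val : ℤ) * t ^ (c i).val) w =
          FreeGroup.lift (fun i => a ^ u₀ i * t ^ (c₀ i).val) w} * orderOf a := by
    simp only [hF, hE]
    exact card_le_card_coset_fiber_mul (hn ▸ pow_dvd_pow p hm) (by simpa using hd) hu
  have hzpow (y z : ℤ) (h : ((p ^ n : ℕ) : ℤ) ∣ y - z) : a ^ z = a ^ y := by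
    rw [zpow_eq_zpow_iff_modEq, hn]
    exact Int.modEq_iff_dvd.2 h
  have htp (z : ℤ) : t ^ (p * z) = a ^ (p * l * z) := by
    rw [zpow_mul, zpow_mul, hl, zpow_natCast]
  generalize FreeGroup.lift (fun i => a ^ u₀ i * t ^ (c₀ i).val) w = g at hbound ⊢
  generalize hcard : (fun c : Fin k → ZMod p => Nat.card {u : Fin k → ZMod (orderOf a) //
        FreeGroup.lift (fun i => a ^ ((u i).val : ℤ) * t ^ (c i).val) w = g}) = F
  simp only [funext_iff] at hcard
  simp only [hcard] at hbound ⊢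
  suffices H : ∃ (S : Finset (Fin k → ZMod p)) (m : (Fin k → ZMod p) → ℕ),
      p ^ k ≤ (∑ c ∈ S, p ^ m c) * p ∧ ∀ c ∈ S, m c ≤ n ∧ (∀ i, (p : ℤ) ^ m c ∣ D i c) ∧
        ∃ u : Fin k → ℤ, a ^ (∑ i, D i c * u i) * t ^ (∑ i, D i 0 * ((c i).val : ℤ)) =
          a ^ (∑ i, D i c₀ * u₀ i) * t ^ (∑ i, D i 0 * ((c₀ i).val : ℤ)) by
    obtain ⟨S, m, hS, H⟩ := H
    calc (p * orderOf a) ^ k = p ^ k * orderOf a ^ k := mul_pow _ _ _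
      _ ≤ (∑ c ∈ S, p ^ m c) * p * orderOf a ^ k := by gcongr
      _ = (∑ c ∈ S, orderOf a ^ k * p ^ m c) * p := by rw [← Finset.mul_sum]; ring
      _ ≤ (∑ c ∈ S, F c * orderOf a) * p := by
        refine Nat.mul_le_mul_right p (Finset.sum_le_sum fun c hc => ?_)
        exact hbound c _ (H c hc).1 (H c hc).2.1 (H c hc).2.2
      _ ≤ (∑ c, F c * orderOf a) * p := by
        gcongr
        exact Finset.subset_univ _
      _ = _ := by rw [← Finset.sum_mul]; ring
  by_cases hdiv : ∀ i, (p : ℤ) ∣ D i 0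
  · have hE' (c : Fin k → ZMod p) : t ^ (∑ i, D i 0 * ((c i).val : ℤ)) =
        a ^ (l * ∑ i, D i 0 * ((c i).val : ℤ)) := by
      obtain ⟨z, hz⟩ : (p : ℤ) ∣ ∑ i, D i 0 * ((c i).val : ℤ) :=
        Finset.dvd_sum fun i _ => (hdiv i).mul_right _
      rw [hz, htp]
      ring_nf
    simp only [hE', ← zpow_add]
    obtain ⟨v, hv⟩ : ∃ v, v = min (depth p n fun i => D i c₀) (depth p n fun i => D i 0) :=
      ⟨_, rfl⟩
    have hv₀ (i) : (p : ℤ) ^ v ∣ D i c₀ :=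
      (pow_dvd_pow _ (hv ▸ min_le_left _ _)).trans (pow_depth_dvd p n (fun i => D i c₀) i)
    have hv₁ (i) : (p : ℤ) ^ v ∣ D i 0 :=
      (pow_dvd_pow _ (hv ▸ min_le_right _ _)).trans (pow_depth_dvd p n (fun i => D i 0) i)
    have hy (c : Fin k → ZMod p) : (p : ℤ) ^ v ∣ ∑ i, D i c₀ * u₀ i +
        l * ∑ i, D i 0 * ((c₀ i).val : ℤ) - l * ∑ i, D i 0 * ((c i).val : ℤ) := by
      refine dvd_sub (dvd_add ?_ (.mul_left ?_ _)) (.mul_left ?_ _)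
      exacts [Finset.dvd_sum fun i _ => (hv₀ i).mul_right _,
        Finset.dvd_sum fun i _ => (hv₁ i).mul_right _, Finset.dvd_sum fun i _ => (hv₁ i).mul_right _]
    have hvn : v ≤ n := hv ▸ (min_le_left _ _).trans (depth_le _ _ _)
    obtain hvn | rfl := hvn.lt_or_eq
    · obtain ⟨c₁, hc₁⟩ : ∃ c₁, ¬ ∀ i, (p : ℤ) ^ (v + 1) ∣ D i c₁ := by
        by_contra! h
        exact absurd (hv ▸ le_min (le_depth hvn (h c₀)) (le_depth hvn (h 0))) (by lia)
      refine ⟨Finset.univ.filter fun c => ¬ ∀ i, (p : ℤ) ^ (v + 1) ∣ D i c,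
        fun c => depth p v fun i => D i c, le_trans ?_ (Nat.le_mul_of_pos_right _ hp.pos),
        fun c hc => ⟨(depth_le _ _ _).trans hvn.le, pow_depth_dvd p v fun i => D i c, ?_⟩⟩
      · exact (pow_le_sum_pow_depth hp hr1 hD hc₁).trans_eq (by congr!)
      obtain ⟨u, hu⟩ := exists_linear_eq (n := n) hp (Finset.mem_filter.1 hc).2 (hy c)
      exact ⟨u, hzpow _ _ (by convert hu using 1; ring)⟩
    · refine ⟨Finset.univ, 0, ?_, fun c _ => ⟨Nat.zero_le _, by simp, 0, hzpow _ _ ?_⟩⟩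
      · simpa [ZMod.card] using Nat.le_mul_of_pos_right _ hp.pos
      · convert hy c using 1
        · push_cast; rfl
        · simp
  · push Not at hdiv
    obtain ⟨i₀, hi₀⟩ := hdiv
    refine ⟨Finset.univ.filter fun c =>
      ∑ i, (D i 0 : ZMod p) * c i = ∑ i, (D i 0 : ZMod p) * c₀ i, 0, ?_,
      fun c hc => ⟨Nat.zero_le _, by simp, ?_⟩⟩
    · have := card_le_card_linear_fiber_mul (one_dvd p) (fun i => D i 0) (by simp) c₀
      simpa [Nat.card_eq_fintype_card, Fintype.card_subtype] using this
    · obtain ⟨z, hz⟩ : (p : ℤ) ∣ ∑ i, D i 0 * ((c i).val : ℤ) - ∑ i, D i 0 * ((c₀ i).val : ℤ) := by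
        rw [← ZMod.intCast_zmod_eq_zero_iff_dvd]
        simpa [sub_eq_zero] using hc
      have hi₁ : ¬ ∀ i, (p : ℤ) ^ (0 + 1) ∣ D i c := fun h => hi₀ <| by
        have := h i₀
        rw [zero_add, pow_one] at this
        exact (dvd_sub_right this).1 (powerSums_modEq hr1 (hD i₀) c 0)
      obtain ⟨u, hu⟩ := exists_linear_eq (n := n) hp hi₁
        (y := ∑ i, D i c₀ * u₀ i - p * l * z) (by simp)
      refine ⟨u, ?_⟩
      rw [sub_eq_iff_eq_add.1 hz, zpow_add, htp, ← mul_assoc, hzpow _ _ hu, ← zpow_add,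
        sub_add_cancel]


/-- Let `p` be a prime and `G` a finite `p`-group with a cyclic
maximal subgroup (i.e. a cyclic subgroup of index `p`). Then for every word `w`
in `k` variables and every `g` in the image of the word map,
`P_{w,G}(g) ≥ 1/|G|`, equivalently `N_{w,G}(g) · |G| ≥ |G|^k`. -/
theorem amit_ashurst_of_cyclic_maximal_subgroup
    {p : ℕ} (hp : p.Prime) {G : Type*} [Group G] [Finite G]
    (hG : IsPGroup p G)
    (A : Subgroup G) (hAcyc : IsCyclic ↥A) (hAindex : A.index = p)
    (k : ℕ) (w : FreeGroup (Fin k)) (g : G)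
    (hg : ∃ v : Fin k → G, (FreeGroup.lift v) w = g) :
    Nat.card {v : Fin k → G // (FreeGroup.lift v) w = g} * Nat.card G
      ≥ Nat.card G ^ k := by
  have _ : Fact p.Prime := ⟨hp⟩
  obtain ⟨a, rfl⟩ := Subgroup.isCyclic_iff_exists_zpowers_eq_top A |>.1 hAcyc
  obtain ⟨v₀, rfl⟩ := hg
  obtain ⟨n, hn⟩ := IsPGroup.iff_orderOf.1 hG a
  have _ : NeZero (orderOf a) := ⟨(orderOf_pos a).ne'⟩
  have hA : (Subgroup.zpowers a).Normal := by
    apply Subgroup.normal_of_index_eq_minFac_card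
    obtain ⟨m, hm⟩ := IsPGroup.iff_card.1 hG
    have hm0 : m ≠ 0 := by
      rintro rfl
      have := Subgroup.index_dvd_card (Subgroup.zpowers a)
      rw [hm, hAindex, pow_zero, Nat.dvd_one] at this
      exact hp.one_lt.ne' this
    rw [hAindex, hm, hp.pow_minFac hm0]
  obtain ⟨t, ht⟩ : ∃ t, t ∉ Subgroup.zpowers a := by
    by_contra! h
    rw [(Subgroup.eq_top_iff' _).2 h, Subgroup.index_top] at hAindex
    exact hp.one_lt.ne hAindex
  by_cases ha : a ∈ Subgroup.zpowers t
  · refine card_pow_le_of_commute (fun x y => ?_) w v₀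
    have hmem (x : G) : x ∈ Subgroup.zpowers t := by
      obtain ⟨⟨c, u⟩, rfl⟩ := (bijective_zpow_mul_pow hA hAindex ht).2 x
      exact mul_mem (zpow_mem ha _) (pow_mem (Subgroup.mem_zpowers t) _)
    obtain ⟨i, rfl⟩ := hmem x
    obtain ⟨j, rfl⟩ := hmem y
    exact zpow_mul_comm t i j
  · exact card_pow_le_of_not_mem_zpowers hn hA hAindex ht ha w v₀
end

section
/- Let p be a prime and let G be a finite nonabelian p-group with a cyclic maximal subgroup (a cyclic subgroup of index p), and let Z be a central subgroup of G of order p. Then for any word w such that G_w ⊆ Z, one has P_{w,G}(g) ≥ 1/|G| for all g ∈ G_w. -/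
/-- If every left difference of a function of degree `m + 1` has degree `m`, and only the trivial
function has degree `0`, then a nontrivial function of degree `m` is nontrivial on a proportion of
at least `1 / 2 ^ m` of the group. -/
lemma card_le_two_pow_mul_card_ne_one {V A : Type*} [Group V] [Finite V] [Group A]
    (S : ℕ → Set (V → A)) (hzero : ∀ f ∈ S 0, f = 1)
    (hdiff : ∀ m, ∀ f ∈ S (m + 1), ∀ h, (fun v => f (h * v) * (f v)⁻¹) ∈ S m)
    (m : ℕ) (f : V → A) (hf : f ∈ S m) (hne : f ≠ 1) :
    Nat.card V ≤ 2 ^ m * {v | f v ≠ 1}.ncard := by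
  induction m generalizing f with
  | zero => exact absurd (hzero f hf) hne
  | succ m ih =>
    by_cases hconst : ∀ h, (fun v => f (h * v) * (f v)⁻¹) = 1
    · have hall : ∀ v, f v = f 1 := fun v => by
        have := congrFun (hconst v) 1
        simpa [mul_inv_eq_one] using this
      have hone : f 1 ≠ 1 := fun h1 => hne (funext fun v => by rw [hall v, h1]; rfl)
      have : {v | f v ≠ 1} = Set.univ := Set.eq_univ_of_forall fun v => by
        simpa [hall v] using hone
      rw [this, Set.ncard_univ]
      exact Nat.le_mul_of_pos_left _ (by positivity)
    · push Not at hconst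
      obtain ⟨h, hh⟩ := hconst
      have key := ih _ (hdiff m f hf h) hh
      have hsub : {v | f (h * v) * (f v)⁻¹ ≠ 1} ⊆
          (fun v => h⁻¹ * v) '' {v | f v ≠ 1} ∪ {v | f v ≠ 1} := by
        intro v hv
        by_cases hv1 : f v = 1
        · left
          exact ⟨h * v, by simpa [hv1] using hv, by simp⟩
        · exact Or.inr hv1
      have hcard := (Set.ncard_le_ncard hsub (Set.toFinite _)).trans (Set.ncard_union_le _ _)
      rw [Set.ncard_image_of_injective _ (mul_right_injective h⁻¹)] at hcard
      calc Nat.card V ≤ 2 ^ m * {v | f (h * v) * (f v)⁻¹ ≠ 1}.ncard := key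
        _ ≤ 2 ^ m * ({v | f v ≠ 1}.ncard + {v | f v ≠ 1}.ncard) := by gcongr
        _ = 2 ^ (m + 1) * {v | f v ≠ 1}.ncard := by ring

/-- In a commutative group, word maps are homomorphisms. -/
lemma FreeGroup.lift_mul_of_forall_mul_comm {α M : Type*} [Group M]
    (hcomm : ∀ x y : M, x * y = y * x) (u v : α → M) (y : FreeGroup α) :
    FreeGroup.lift (u * v) y = FreeGroup.lift u y * FreeGroup.lift v y := by
  let _ : CommGroup M := { ‹Group M› with mul_comm := hcomm }
  have : FreeGroup.lift (u * v) = FreeGroup.lift u * FreeGroup.lift v := by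
    ext i; simp
  exact DFunLike.congr_fun this y

lemma FreeGroup.map_lift_apply {α M N : Type*} [Group M] [Group N] (φ : M →* N) (v : α → M)
    (y : FreeGroup α) : φ (FreeGroup.lift v y) = FreeGroup.lift (φ ∘ v) y := by
  have : φ.comp (FreeGroup.lift v) = FreeGroup.lift (φ ∘ v) := by ext i; simp
  exact DFunLike.congr_fun this y

lemma MulAut.mul_comm_of_isCyclic {A : Type*} [Group A] [IsCyclic A] (σ τ : MulAut A) :
    σ * τ = τ * σ :=
  (IsCyclic.mulAutMulEquiv A).injective (by rw [map_mul, map_mul, mul_comm])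

section TwistedFunctions

variable {α G A : Type*} [Group G] [Group A]

/-- The group of functions on `G ^ α` generated by `v ↦ θ (y(v)) c`, where `y` is a word and `c`
satisfies `c ^ (p ^ m) = 1`. -/
def twistedFunctions (α : Type*) (p : ℕ) (θ : G →* MulAut A) (m : ℕ) :
    Subgroup ((α → G) → A) :=
  Subgroup.closure {f | ∃ (y : FreeGroup α) (c : A), c ^ p ^ m = 1 ∧
    ∀ v, f v = θ (FreeGroup.lift v y) c}

variable {p m : ℕ} {θ : G →* MulAut A}

lemma eq_one_of_mem_twistedFunctions_zero {f : (α → G) → A}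
    (hf : f ∈ twistedFunctions α p θ 0) : f = 1 := by
  have hle : twistedFunctions α p θ 0 ≤ ⊥ := by
    refine (Subgroup.closure_le _).2 ?_
    rintro f ⟨y, c, hc, hf⟩
    have hc : c = 1 := by simpa using hc
    exact Subgroup.mem_bot.2 (funext fun v => by simp [hf, hc])
  simpa using hle hf

lemma const_mem_twistedFunctions {c : A} (hc : c ^ p ^ m = 1) :
    (fun _ => c) ∈ twistedFunctions α p θ m :=
  Subgroup.subset_closure ⟨1, c, hc, fun v => by simp⟩

lemma twist_mem_twistedFunctions {f : (α → G) → A} (hf : f ∈ twistedFunctions α p θ m)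
    (x : FreeGroup α) : (fun v => θ (FreeGroup.lift v x) (f v)) ∈ twistedFunctions α p θ m := by
  refine Subgroup.closure_induction
    (p := fun f _ => (fun v => θ (FreeGroup.lift v x) (f v)) ∈ twistedFunctions α p θ m)
    ?_ ?_ ?_ ?_ hf
  · rintro f ⟨y, c, hc, hf⟩
    exact Subgroup.subset_closure ⟨x * y, c, hc, fun v => by simp [hf]⟩
  · simpa using const_mem_twistedFunctions (α := α) (θ := θ) (one_pow (p ^ m))
  · intro f g _ _ hf hg
    simpa [Pi.mul_def] using mul_mem hf hg
  · intro f _ hf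
    simpa [Pi.inv_def] using inv_mem hf

variable [IsCyclic A]

lemma map_lift_mul (θ : G →* MulAut A) (u v : α → G) (y : FreeGroup α) :
    θ (FreeGroup.lift (u * v) y) = θ (FreeGroup.lift u y) * θ (FreeGroup.lift v y) := by
  simp only [FreeGroup.map_lift_apply]
  rw [← FreeGroup.lift_mul_of_forall_mul_comm MulAut.mul_comm_of_isCyclic]
  congr 2
  ext1 i
  simp

lemma apply_mul_of_mem_twistedFunctions {f : (α → G) → A} (hf : f ∈ twistedFunctions α p θ m)
    {a : α → G} (ha : ∀ i, θ (a i) = 1) (v : α → G) : f (a * v) = f v := by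
  refine Subgroup.closure_induction (p := fun f _ => f (a * v) = f v) ?_ ?_ ?_ ?_ hf
  · rintro f ⟨y, c, -, hf⟩
    have hone : θ (FreeGroup.lift a y) = 1 := by
      rw [FreeGroup.map_lift_apply, show θ ∘ a = 1 from funext ha]
      have : FreeGroup.lift (1 : α → MulAut A) = 1 := by ext1 i; simp
      rw [this, MonoidHom.one_apply]
    rw [hf, hf, map_lift_mul, hone, one_mul]
  · rfl
  · intro f g _ _ hf hg
    simp [hf, hg]
  · intro f _ hf
    simp [hf]

lemma difference_mem_twistedFunctions (hθ : ∀ d : A, d ^ p = 1 → ∀ g, θ g d = d)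
    {f : (α → G) → A} (hf : f ∈ twistedFunctions α p θ (m + 1)) (h : α → G) :
    (fun v => f (h * v) * (f v)⁻¹) ∈ twistedFunctions α p θ m := by
  let _ : CommGroup A := IsCyclic.commGroup
  refine Subgroup.closure_induction
    (p := fun f _ => (fun v => f (h * v) * (f v)⁻¹) ∈ twistedFunctions α p θ m)
    ?_ ?_ ?_ ?_ hf
  · rintro f ⟨y, c, hc, hf⟩
    refine Subgroup.subset_closure ⟨y, θ (FreeGroup.lift h y) c * c⁻¹, ?_, fun v => ?_⟩
    · rw [mul_pow, ← map_pow, hθ _ (by rw [← pow_mul, ← pow_succ, hc]), inv_pow, mul_inv_cancel]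
    · simp only [hf]
      rw [map_lift_mul, MulAut.mul_comm_of_isCyclic, map_mul, map_inv, MulAut.mul_apply]
  · simpa using const_mem_twistedFunctions (α := α) (θ := θ) (one_pow (p ^ m))
  · intro f g _ _ hf hg
    convert mul_mem hf hg using 1
    ext1 v
    simp only [Pi.mul_apply]
    exact mul_inv (f v) (g v) ▸ mul_mul_mul_comm _ _ _ _
  · intro f _ hf
    convert inv_mem hf using 1
    ext1 v
    simp only [Pi.inv_apply]
    exact (mul_inv _ _).symm

end TwistedFunctions

/-- Translating the arguments of a word map by elements of a normal subgroup `A` changes its value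
by a twisted function. -/
lemma exists_mem_twistedFunctions_lift_mul {α G : Type*} [Group G] {A : Subgroup G} [A.Normal]
    {p m : ℕ} (hA : ∀ c : A, c ^ p ^ m = 1) (a : α → A) (y : FreeGroup α) :
    ∃ f ∈ twistedFunctions α p (MulAut.conjNormal (H := A)) m, ∀ v : α → G,
      FreeGroup.lift ((fun i => (a i : G)) * v) y = f v * FreeGroup.lift v y := by
  have hinv : ∀ x : FreeGroup α,
      (∃ f ∈ twistedFunctions α p (MulAut.conjNormal (H := A)) m, ∀ v : α → G,
        FreeGroup.lift ((fun i => (a i : G)) * v) x = f v * FreeGroup.lift v x) →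
      ∃ f ∈ twistedFunctions α p (MulAut.conjNormal (H := A)) m, ∀ v : α → G,
        FreeGroup.lift ((fun i => (a i : G)) * v) x⁻¹ = f v * FreeGroup.lift v x⁻¹ := by
    rintro x ⟨f, hf, hfx⟩
    refine ⟨_, twist_mem_twistedFunctions (inv_mem hf) x⁻¹, fun v => ?_⟩
    rw [MulAut.conjNormal_apply, map_inv, hfx]
    simp
  induction y using FreeGroup.induction_on with
  | C1 => exact ⟨1, one_mem _, fun v => by simp⟩
  | of i => exact ⟨_, const_mem_twistedFunctions (hA (a i)), fun v => by simp⟩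
  | inv_of i ih => exact hinv _ ih
  | mul x y ihx ihy =>
    obtain ⟨f, hf, hfx⟩ := ihx
    obtain ⟨g, hg, hgy⟩ := ihy
    refine ⟨_, mul_mem hf (twist_mem_twistedFunctions hg x), fun v => ?_⟩
    simp only [map_mul, hfx, hgy, Pi.mul_apply, Subgroup.coe_mul, MulAut.conjNormal_apply]
    group

/-- A subgroup of prime index is maximal. -/
lemma sup_eq_top_of_index_prime {G : Type*} [Group G] {A B : Subgroup G} (hindex : A.index.Prime)
    (hB : ¬ B ≤ A) : A ⊔ B = ⊤ := by
  have hdvd := Subgroup.index_dvd_of_le (le_sup_left : A ≤ A ⊔ B)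
  rcases (Nat.dvd_prime hindex).1 hdvd with h | h
  · exact Subgroup.index_eq_one.1 h
  · have hrel := Subgroup.relIndex_mul_index (le_sup_left : A ≤ A ⊔ B)
    rw [h, Nat.mul_eq_right hindex.ne_zero] at hrel
    exact absurd (le_sup_right.trans (Subgroup.relIndex_eq_one.1 hrel)) hB

/-- In a nonabelian group, an abelian subgroup of prime index contains the center. -/
lemma center_le_of_index_prime {G : Type*} [Group G] (hnonab : ¬ ∀ x y : G, x * y = y * x)
    {A : Subgroup G} (hA : IsMulCommutative A) (hindex : A.index.Prime) :
    Subgroup.center G ≤ A := by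
  intro z hz
  by_contra hzA
  refine hnonab ?_
  have htop : A ⊔ Subgroup.center G = ⊤ := sup_eq_top_of_index_prime hindex fun h => hzA (h hz)
  intro x y
  have hx : x ∈ A ⊔ Subgroup.center G := htop ▸ Subgroup.mem_top x
  have hy : y ∈ A ⊔ Subgroup.center G := htop ▸ Subgroup.mem_top y
  rw [Subgroup.mem_sup_of_normal_right] at hx hy
  obtain ⟨a, ha, c, hc, rfl⟩ := hx
  obtain ⟨b, hb, d, hd, rfl⟩ := hy
  have hab : a * b = b * a := congrArg Subtype.val (hA.is_comm.comm ⟨a, ha⟩ ⟨b, hb⟩)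
  have hc' := Subgroup.mem_center_iff.1 hc
  have hd' := Subgroup.mem_center_iff.1 hd
  calc a * c * (b * d) = a * (c * b) * d := by group
    _ = a * b * (c * d) := by rw [← hc' b]; group
    _ = b * a * (d * c) := by rw [hab, hd' c]
    _ = b * (a * d) * c := by group
    _ = b * d * (a * c) := by rw [hd' a]; group

/-- A subgroup of order `p` of a finite cyclic subgroup contains all its elements of
exponent `p`. -/
lemma mem_of_pow_eq_one_of_isCyclic {G : Type*} [Group G] [Finite G] {p : ℕ} (hp : 0 < p)
    {A Z : Subgroup G} [IsCyclic A] (hZA : Z ≤ A) (hZ : Nat.card Z = p) {d : G} (hd : d ∈ A)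
    (hdp : d ^ p = 1) : d ∈ Z := by
  classical
  have := Fintype.ofFinite A
  have hle := IsCyclic.card_pow_eq_one_le (α := A) hp
  have hsub : (Z.subgroupOf A : Set A) ⊆ {c : A | c ^ p = 1} := fun c hc => by
    have h1 := pow_card_eq_one' (x := (⟨c, hc⟩ : Z))
    rw [hZ] at h1
    exact Subtype.ext (by simpa using congrArg Subtype.val h1)
  have hcard : (Z.subgroupOf A : Set A).ncard = p := by
    rw [← Nat.card_coe_set_eq, ← hZ]
    exact Nat.card_congr (Subgroup.subgroupOfEquivOfLe hZA).toEquiv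
  have heq := Set.eq_of_subset_of_ncard_le hsub (by
    rw [hcard, Set.ncard_eq_toFinset_card']
    simpa using hle) (Set.toFinite _)
  have hmem : (⟨d, hd⟩ : A) ∈ (Z.subgroupOf A : Set A) := by
    rw [heq]
    exact Subtype.ext (by simpa using hdp)
  exact hmem

/-- If translating the arguments by elements of a normal subgroup `A` of prime index does not change
the value of a word map, then the nonempty fibres of the word map all have the same size. -/
lemma card_fiber_le_card_fiber_of_invariant {G : Type*} [Group G] [Finite G] {k : ℕ}
    {A : Subgroup G} [A.Normal] (hindex : A.index.Prime) (w : FreeGroup (Fin k))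
    (hinv : ∀ (a : Fin k → A) (v : Fin k → G),
      FreeGroup.lift ((fun i => (a i : G)) * v) w = FreeGroup.lift v w)
    {g : G} (hg : ∃ v : Fin k → G, FreeGroup.lift v w = g) (g' : G) :
    {v : Fin k → G | FreeGroup.lift v w = g'}.ncard ≤
      {v : Fin k → G | FreeGroup.lift v w = g}.ncard := by
  obtain ⟨b, hb⟩ : ∃ b, b ∉ A := by
    by_contra! h
    exact hindex.one_lt.ne' (Subgroup.index_eq_one.2 (eq_top_iff.2 fun x _ => h x))
  have htop : A ⊔ Subgroup.zpowers b = ⊤ :=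
    sup_eq_top_of_index_prime hindex fun h => hb (h (Subgroup.mem_zpowers b))
  have hdecomp : ∀ v : Fin k → G, ∃ (a : Fin k → A) (β : Fin k → Subgroup.zpowers b),
      v = (fun i => (a i : G)) * (fun i => (β i : G)) := by
    intro v
    have : ∀ i, ∃ (a : A) (β : Subgroup.zpowers b), v i = a * β := fun i => by
      have hi : v i ∈ A ⊔ Subgroup.zpowers b := htop ▸ Subgroup.mem_top _
      rw [Subgroup.mem_sup_of_normal_left] at hi
      obtain ⟨a, ha, β, hβ, h⟩ := hi
      exact ⟨⟨a, ha⟩, ⟨β, hβ⟩, h.symm⟩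
    choose a β h using this
    exact ⟨a, β, funext h⟩
  have hcomm : ∀ x y : Subgroup.zpowers b, x * y = y * x :=
    (IsCyclic.commGroup (α := Subgroup.zpowers b)).mul_comm
  have hmul : ∀ β γ : Fin k → Subgroup.zpowers b,
      FreeGroup.lift ((fun i => (β i : G)) * fun i => (γ i : G)) w =
        FreeGroup.lift (fun i => (β i : G)) w * FreeGroup.lift (fun i => (γ i : G)) w := by
    intro β γ
    have hcoe : ∀ δ : Fin k → Subgroup.zpowers b,
        FreeGroup.lift (fun i => (δ i : G)) w = (FreeGroup.lift δ w : Subgroup.zpowers b) :=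
      fun δ => (FreeGroup.map_lift_apply (Subgroup.zpowers b).subtype δ w).symm
    rw [hcoe, hcoe, ← Subgroup.coe_mul, ← FreeGroup.lift_mul_of_forall_mul_comm hcomm, ← hcoe]
    rfl
  have hmul' : ∀ (v : Fin k → G) (γ : Fin k → Subgroup.zpowers b),
      FreeGroup.lift (v * fun i => (γ i : G)) w =
        FreeGroup.lift v w * FreeGroup.lift (fun i => (γ i : G)) w := by
    intro v γ
    obtain ⟨a, β, rfl⟩ := hdecomp v
    rw [mul_assoc, hinv, hinv, hmul]
  have hrep : ∀ v : Fin k → G, ∃ β : Fin k → Subgroup.zpowers b,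
      FreeGroup.lift (fun i => (β i : G)) w = FreeGroup.lift v w := by
    intro v
    obtain ⟨a, β, rfl⟩ := hdecomp v
    exact ⟨β, (hinv a _).symm⟩
  rcases Set.eq_empty_or_nonempty {v : Fin k → G | FreeGroup.lift v w = g'} with h | ⟨v', hv'⟩
  · simp [h]
  obtain ⟨v, hv⟩ := hg
  obtain ⟨β, hβ⟩ := hrep v
  obtain ⟨β', hβ'⟩ := hrep v'
  have hquot : FreeGroup.lift (fun i => ((β'⁻¹ * β) i : G)) w = g'⁻¹ * g := by
    have := hmul β' (β'⁻¹ * β)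
    rw [hβ', hv'] at this
    rw [← hv, ← hβ, eq_inv_mul_iff_mul_eq, ← this]
    congr 2
    ext1 i
    simp
  refine Set.ncard_le_ncard_of_injOn (fun u => u * fun i => ((β'⁻¹ * β) i : G)) ?_
    (mul_left_injective _).injOn (Set.toFinite _)
  intro u hu
  simp only [Set.mem_ofPred_eq] at hu ⊢
  rw [hmul', hquot, hu, mul_inv_cancel_left]

/-- Let `G` be a finite nonabelian `p`-group with a cyclic
maximal subgroup (a cyclic subgroup of index `p`), and let `Z` be a central
subgroup of `G` of order `p`. Then for any word `w` with `G_w ⊆ Z`,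
`P_{w,G}(g) ≥ 1/|G|` for all `g ∈ G_w`. -/
theorem amit_ashurst_of_image_in_central_Z
    {p : ℕ} (hp : p.Prime) {G : Type*} [Group G] [Finite G] (hG : IsPGroup p G)
    (hnonab : ¬ ∀ x y : G, x * y = y * x)
    (A : Subgroup G) (hAcyc : IsCyclic ↥A) (hAindex : A.index = p)
    (Z : Subgroup G) (hZcentral : Z ≤ Subgroup.center G) (hZcard : Nat.card Z = p)
    (k : ℕ) (w : FreeGroup (Fin k))
    (hwZ : ∀ g : G, (∃ v : Fin k → G, (FreeGroup.lift v) w = g) → g ∈ Z)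
    (g : G) (hg : ∃ v : Fin k → G, (FreeGroup.lift v) w = g) :
    (Nat.card {v : Fin k → G // (FreeGroup.lift v) w = g} : ℝ) / (Nat.card G : ℝ) ^ k
      ≥ 1 / (Nat.card G : ℝ) := by
  classical
  have := Fact.mk hp
  have hcard_ne : Nat.card G ≠ 1 := fun h => by
    have := (Nat.card_eq_one_iff_unique.1 h).1
    exact hnonab fun x y => Subsingleton.elim _ _
  have hnormal : A.Normal := by
    apply Subgroup.normal_of_index_eq_minFac_card
    obtain ⟨n, hn⟩ := IsPGroup.iff_card.1 hG
    have hn0 : n ≠ 0 := by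
      rintro rfl
      exact hcard_ne (by simpa using hn)
    rw [hAindex, hn, hp.pow_minFac hn0]
  obtain ⟨m, hm⟩ := IsPGroup.iff_card.1 (hG.to_subgroup A)
  have hcard : p ^ m * p = Nat.card G := by rw [← hm, ← hAindex, A.card_mul_index]
  have hindex : A.index.Prime := hAindex ▸ hp
  have hAcomm : IsMulCommutative A := ⟨⟨fun x y => (IsCyclic.commGroup (α := A)).mul_comm x y⟩⟩
  have hZA : Z ≤ A := hZcentral.trans (center_le_of_index_prime hnonab hAcomm hindex)
  suffices hmain : Nat.card G ^ k ≤ Nat.card G * {v : Fin k → G | FreeGroup.lift v w = g}.ncard by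
    have hpos : (0 : ℝ) < Nat.card G := by exact_mod_cast Nat.card_pos
    rw [ge_iff_le, div_le_div_iff₀ hpos (by positivity), one_mul, mul_comm]
    exact_mod_cast hmain
  have hcardV : Nat.card (Fin k → G) = Nat.card G ^ k := by simp [Nat.card_fun]
  rw [← hcardV]
  by_cases hinv : ∀ (a : Fin k → A) (v : Fin k → G),
      FreeGroup.lift ((fun i => (a i : G)) * v) w = FreeGroup.lift v w
  · have hfib := card_fiber_le_card_fiber_of_invariant hindex w hinv hg
    have : Fintype Z := Fintype.ofFinite Z
    have : Fintype (Fin k → G) := Fintype.ofFinite _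
    have hcover := Finset.card_le_mul_card_image_of_maps_to
      (s := (Finset.univ : Finset (Fin k → G))) (t := (Finset.univ : Finset Z))
      (f := fun v => ⟨FreeGroup.lift v w, hwZ _ ⟨v, rfl⟩⟩) (fun _ _ => Finset.mem_univ _)
      {v : Fin k → G | FreeGroup.lift v w = g}.ncard (fun z _ => by
        refine le_trans (le_of_eq ?_) (hfib z)
        rw [← Set.ncard_coe_finset]
        congr 1
        ext v
        simp [Subtype.ext_iff])
    rw [Finset.card_univ, Finset.card_univ, ← Nat.card_eq_fintype_card,
      ← Nat.card_eq_fintype_card, hZcard, mul_comm] at hcover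
    refine hcover.trans (Nat.mul_le_mul_right _ ?_)
    rw [← hcard]
    exact Nat.le_mul_of_pos_left _ (pow_pos hp.pos m)
  · push Not at hinv
    obtain ⟨a, v₀, hv₀⟩ := hinv
    obtain ⟨f, hf, hfw⟩ := exists_mem_twistedFunctions_lift_mul (p := p) (m := m)
      (fun c : A => hm ▸ pow_card_eq_one') a w
    have hfne : f ≠ 1 := by
      rintro rfl
      exact hv₀ (by simpa using hfw v₀)
    have hfix : ∀ d : A, d ^ p = 1 → ∀ x : G, MulAut.conjNormal (H := A) x d = d := by
      intro d hd x
      have hdZ : (d : G) ∈ Z :=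
        mem_of_pow_eq_one_of_isCyclic hp.pos hZA hZcard d.2 (by simpa using congrArg Subtype.val hd)
      ext
      rw [MulAut.conjNormal_apply, Subgroup.mem_center_iff.1 (hZcentral hdZ) x,
        mul_inv_cancel_right]
    have hsupp := card_le_two_pow_mul_card_ne_one
      (fun m => (twistedFunctions (Fin k) p (MulAut.conjNormal (H := A)) m : Set _))
      (fun f hf => eq_one_of_mem_twistedFunctions_zero hf)
      (fun m f hf h => difference_mem_twistedFunctions hfix hf h) m f hf hfne
    have htriv : ∀ c : A, MulAut.conjNormal (H := A) (c : G) = 1 := by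
      intro c
      ext d
      have hcd : (c : G) * d = d * c := congrArg Subtype.val (hAcomm.is_comm.comm c d)
      rw [MulAut.conjNormal_apply, hcd, mul_inv_cancel_right, MulAut.one_apply]
    have hpow : ∀ (j : ℕ) (v : Fin k → G),
        FreeGroup.lift ((fun i => (a i : G)) ^ j * v) w = (f v : G) ^ j * FreeGroup.lift v w := by
      intro j v
      induction j with
      | zero => simp
      | succ j ih =>
        rw [pow_succ', mul_assoc, hfw, ih, pow_succ', mul_assoc]
        congr 2
        refine apply_mul_of_mem_twistedFunctions hf (fun i => ?_) v
        simpa using congrArg (· ^ j) (htriv (a i))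
    have hreach : ∀ v, f v ≠ 1 → ∃ j < p,
        FreeGroup.lift ((fun i => (a i : G)) ^ j * v) w = g := by
      intro v hv
      have hvZ := hwZ _ ⟨v, rfl⟩
      have hfZ : (f v : G) ∈ Z := by
        have := hwZ _ ⟨_, hfw v⟩
        rwa [Z.mul_mem_cancel_right hvZ] at this
      have hzne : (⟨f v, hfZ⟩ : Z) ≠ 1 := fun h => hv (Subtype.ext (by simpa using congrArg Subtype.val h))
      obtain ⟨j, hj⟩ := mem_powers_of_prime_card hZcard hzne
        (g' := ⟨g, hwZ g hg⟩ * (⟨_, hvZ⟩ : Z)⁻¹)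
      refine ⟨j % p, Nat.mod_lt _ hp.pos, ?_⟩
      have hj' : (f v : G) ^ j = g * (FreeGroup.lift v w)⁻¹ := by
        simpa using congrArg Subtype.val hj
      have hmod : (f v : G) ^ (j % p) = (f v : G) ^ j := by
        have h1 := congrArg Subtype.val (pow_mod_natCard (⟨f v, hfZ⟩ : Z) j)
        rw [hZcard] at h1
        simpa using h1
      rw [hpow, hmod, hj', inv_mul_cancel_right]
    choose! j hjp hjg using hreach
    have hfiber : {v | f v ≠ 1}.ncard ≤
        {v : Fin k → G | FreeGroup.lift v w = g}.ncard * p := by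
      have hle := Set.ncard_le_ncard_of_injOn (s := {v | f v ≠ 1})
        (t := {v : Fin k → G | FreeGroup.lift v w = g} ×ˢ (Set.Iio p))
        (fun v => ((fun i => (a i : G)) ^ j v * v, j v))
        (fun v hv => ⟨hjg v hv, hjp v hv⟩)
        (fun u _ v _ huv => by
          simp only [Prod.mk.injEq] at huv
          rw [huv.2] at huv
          exact mul_left_cancel huv.1)
        (Set.toFinite _)
      rwa [Set.ncard_prod, Set.ncard_Iio_nat] at hle
    calc Nat.card (Fin k → G) ≤ 2 ^ m * {v | f v ≠ 1}.ncard := hsupp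
      _ ≤ p ^ m * ({v : Fin k → G | FreeGroup.lift v w = g}.ncard * p) := by
        gcongr
        exact hp.two_le
      _ = Nat.card G * {v : Fin k → G | FreeGroup.lift v w = g}.ncard := by
        rw [← hcard]; ring
end

section
/- Let p be a prime, let G be a finite nonabelian p-group with a cyclic maximal subgroup (a cyclic subgroup of index p), and let Z be a central subgroup of G of order p. If w is a word with G_w ⊆ Z and G_w ≠ {1}, then G_w = Z. -/
open scoped commutatorElement

/-- If `s` and `t` are `p`-th roots of unity modulo `p ^ k`, with `p` odd, then
`(s - 1) * (t - 1)` vanishes modulo `p ^ k`. -/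
theorem Int.prime_pow_dvd_sub_one_mul_sub_one {p : ℕ} (hp : p.Prime) (hodd : Odd p) (k : ℕ)
    {s t : ℤ} (hs : (p : ℤ) ^ k ∣ s ^ p - 1) (ht : (p : ℤ) ^ k ∣ t ^ p - 1) :
    (p : ℤ) ^ k ∣ (s - 1) * (t - 1) := by
  have := Fact.mk hp
  rcases Nat.eq_zero_or_pos k with rfl | hk
  · simp
  have key : ∀ r : ℤ, (p : ℤ) ^ k ∣ r ^ p - 1 → (p : ℤ) ∣ r - 1 := by
    intro r hr
    have h := (dvd_pow_self (p : ℤ) hk.ne').trans hr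
    rw [← ZMod.intCast_zmod_eq_zero_iff_dvd] at h ⊢
    simpa [ZMod.pow_card] using h
  have hs1 := key s hs
  have hndvd : ¬ (p : ℤ) ∣ s := fun h => by
    have h1 : (p : ℤ) ∣ 1 := by simpa using dvd_sub h hs1
    exact (Nat.prime_iff_prime_int.mp hp).not_dvd_one h1
  have hlte := Int.emultiplicity_pow_sub_pow hp hodd hs1 hndvd p
  rw [one_pow] at hlte
  have hdvd : (p : ℤ) ^ k ∣ (s - 1) * p := by
    rw [pow_dvd_iff_le_emultiplicity] at hs ⊢
    rw [emultiplicity_mul (Nat.prime_iff_prime_int.mp hp), Int.natCast_emultiplicity]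
    rwa [hlte] at hs
  exact hdvd.trans (mul_dvd_mul_left _ (key t ht))

/-- For odd `p`, a finite `p`-group with a cyclic subgroup of index `p` has nilpotency class at
most two. -/
theorem IsPGroup.commutatorElement_mem_center_of_isCyclic_of_index_eq {p : ℕ} (hp : p.Prime)
    (hodd : Odd p) {G : Type*} [Group G] [Finite G] (hG : IsPGroup p G) (A : Subgroup G)
    (hAcyc : IsCyclic A) (hAindex : A.index = p) (x y : G) :
    ⁅x, y⁆ ∈ Subgroup.center G := by
  have := Fact.mk hp
  have hne : Nat.card G ≠ 1 := fun h => by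
    have h1 := A.index_dvd_card
    rw [hAindex, h] at h1
    exact hp.one_lt.ne' (Nat.dvd_one.mp h1)
  have hA : A.Normal := by
    apply Subgroup.normal_of_index_eq_minFac_card
    obtain ⟨n, hn⟩ := IsPGroup.iff_card.mp hG
    have hn0 : n ≠ 0 := by
      rintro rfl
      exact hne (by simpa using hn)
    rw [hAindex, hn, hp.pow_minFac hn0]
  obtain ⟨⟨a, haA⟩, ha⟩ := hAcyc.exists_generator
  have hgen : ∀ x ∈ A, ∃ j : ℤ, a ^ j = x := by
    intro x hx
    obtain ⟨j, hj⟩ := Subgroup.mem_zpowers_iff.mp (ha ⟨x, hx⟩)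
    exact ⟨j, by simpa using congrArg Subtype.val hj⟩
  obtain ⟨k, hk⟩ := (IsPGroup.iff_orderOf.mp hG) a
  have hone : ∀ m : ℤ, a ^ m = 1 ↔ (p : ℤ) ^ k ∣ m := by
    intro m
    rw [← orderOf_dvd_iff_zpow_eq_one, hk]
    push_cast
    rfl
  have hact : ∀ h : G, ∃ s : ℤ, h * a * h⁻¹ = a ^ s ∧ (p : ℤ) ^ k ∣ s ^ p - 1 := by
    intro h
    obtain ⟨s, hs⟩ := hgen _ (hA.conj_mem a haA h)
    refine ⟨s, hs.symm, ?_⟩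
    have hiter : ∀ n : ℕ, h ^ n * a * (h ^ n)⁻¹ = a ^ (s ^ n) := by
      intro n
      induction n with
      | zero => simp
      | succ n ih =>
        calc h ^ (n + 1) * a * (h ^ (n + 1))⁻¹ = h * (h ^ n * a * (h ^ n)⁻¹) * h⁻¹ := by
              rw [pow_succ']; group
          _ = (h * a * h⁻¹) ^ (s ^ n) := by rw [ih, conj_zpow]
          _ = a ^ (s ^ (n + 1)) := by rw [← hs, ← zpow_mul, pow_succ']
    have hpA : h ^ p ∈ A := by
      rw [← hAindex]
      exact A.pow_index_mem h
    obtain ⟨j, hj⟩ := hgen _ hpA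
    rw [← hone, zpow_sub, ← hiter, ← hj]
    group
  have hcomm : ∀ h : G, ⁅h, a⁆ ∈ Subgroup.center G := by
    intro h
    rw [Subgroup.mem_center_iff]
    intro g
    obtain ⟨s, hs, hsp⟩ := hact h
    obtain ⟨t, ht, htp⟩ := hact g
    have hc : ⁅h, a⁆ = a ^ (s - 1) := by
      rw [commutatorElement_def, hs, zpow_sub, zpow_one]
    have hfix : g * a ^ (s - 1) * g⁻¹ = a ^ (s - 1) := by
      rw [← conj_zpow, ht, ← zpow_mul, ← div_eq_one, div_eq_mul_inv, ← zpow_sub, hone]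
      have := Int.prime_pow_dvd_sub_one_mul_sub_one hp hodd k hsp htp
      convert this using 1
      ring
    rw [hc]
    exact mul_inv_eq_iff_eq_mul.mp hfix
  let π := QuotientGroup.mk' (Subgroup.center G)
  have hπ : Function.Surjective π := QuotientGroup.mk'_surjective _
  let B := A.map π
  have : B.Normal := hA.map π hπ
  have hB : B ≤ Subgroup.center (G ⧸ Subgroup.center G) := by
    rintro _ ⟨x, hx, rfl⟩
    obtain ⟨j, rfl⟩ := hgen x hx
    rw [map_zpow]
    refine Subgroup.zpow_mem _ (Subgroup.mem_center_iff.mpr fun g => ?_) j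
    obtain ⟨g, rfl⟩ := hπ g
    rw [← commutatorElement_eq_one_iff_mul_comm, ← map_commutatorElement]
    exact (QuotientGroup.eq_one_iff _).mpr (hcomm g)
  have : IsCyclic (G ⧸ A) := isCyclic_of_prime_card (p := p) hAindex
  have hcyc : IsCyclic ((G ⧸ Subgroup.center G) ⧸ B) := by
    refine isCyclic_of_surjective (QuotientGroup.map A B π (Subgroup.le_comap_map π A)) ?_
    intro q
    obtain ⟨q, rfl⟩ := QuotientGroup.mk'_surjective B q
    obtain ⟨g, rfl⟩ := hπ q
    exact ⟨(g : G ⧸ A), rfl⟩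
  have hab := (MonoidHom.isMulCommutative_of_isCyclic_of_ker_le_center (QuotientGroup.mk' B)
    (by rwa [QuotientGroup.ker_mk'])).is_comm.comm (π x) (π y)
  rw [← commutatorElement_eq_one_iff_mul_comm, ← map_commutatorElement] at hab
  exact (QuotientGroup.eq_one_iff _).mp hab

/-- In a group of nilpotency class at most two, commuting with a fixed element `u` is a
homomorphism to the center. -/
def commutatorCenterHom {G : Type*} [Group G] (hc : ∀ x y : G, ⁅x, y⁆ ∈ Subgroup.center G)
    (u : G) : G →* Subgroup.center G where
  toFun g := ⟨⁅g, u⁆, hc g u⟩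
  map_one' := by simp
  map_mul' x y := by
    apply Subtype.ext
    have h := Subgroup.mem_center_iff.mp (hc y u) x
    calc ⁅x * y, u⁆ = x * ⁅y, u⁆ * u * x⁻¹ * u⁻¹ := by
          simp only [commutatorElement_def]; group
      _ = ⁅y, u⁆ * ⁅x, u⁆ := by rw [h]; simp only [commutatorElement_def]; group
      _ = ⁅x, u⁆ * ⁅y, u⁆ := (Subgroup.mem_center_iff.mp (hc y u) _).symm

open scoped IsMulCommutative in
/-- In a group of nilpotency class at most two, a word map depends on each single variable through
a power and a homomorphism to the center. -/
theorem FreeGroup.exists_lift_update_eq {G ι : Type*} [Group G] [DecidableEq ι]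
    (hc : ∀ x y : G, ⁅x, y⁆ ∈ Subgroup.center G) (v : ι → G) (i : ι) (w : FreeGroup ι) :
    ∃ (e : ℤ) (φ : G →* Subgroup.center G), ∀ g : G,
      FreeGroup.lift (Function.update v i g) w =
        FreeGroup.lift (Function.update v i 1) w * g ^ e * φ g := by
  induction w using FreeGroup.induction_on with
  | C1 => exact ⟨0, 1, by simp⟩
  | of j =>
    by_cases hj : j = i
    · subst hj
      exact ⟨1, 1, by simp⟩
    · exact ⟨0, 1, by simp [hj]⟩
  | inv_of j _ =>
    by_cases hj : j = i
    · subst hj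
      exact ⟨-1, 1, by simp⟩
    · exact ⟨0, 1, by simp [hj]⟩
  | mul x y hx hy =>
    obtain ⟨e, φ, hφ⟩ := hx
    obtain ⟨f, ψ, hψ⟩ := hy
    set u := FreeGroup.lift (Function.update v i 1) x
    set t := FreeGroup.lift (Function.update v i 1) y
    refine ⟨e + f, φ * ψ * commutatorCenterHom hc t ^ e, fun g => ?_⟩
    have hswap : g ^ e * t = t * g ^ e * (commutatorCenterHom hc t g : G) ^ e := by
      have h1 : (commutatorCenterHom hc t g : G) ^ e = ⁅g ^ e, t⁆ := by
        rw [← Subgroup.coe_zpow, ← map_zpow]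
        rfl
      rw [h1, Subgroup.mem_center_iff.mp (hc _ _), commutatorElement_def]
      group
    have hcen : ∀ (z : Subgroup.center G) (a : G), (z : G) * a = a * z := fun z a =>
      (Subgroup.mem_center_iff.mp z.2 a).symm
    have hpow : ((commutatorCenterHom hc t g ^ e : Subgroup.center G) : G)
        = (commutatorCenterHom hc t g : G) ^ e := Subgroup.coe_zpow _ _ _
    rw [_root_.map_mul, _root_.map_mul, hφ, hψ]
    calc u * g ^ e * φ g * (t * g ^ f * ψ g)
        = u * (g ^ e * t) * g ^ f * ψ g * φ g := by
          rw [mul_assoc _ (φ g : G), hcen]; group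
      _ = u * t * g ^ e * (((commutatorCenterHom hc t g ^ e : Subgroup.center G) : G) * g ^ f)
            * ψ g * φ g := by
          rw [hswap, hpow]; group
      _ = u * t * g ^ (e + f) *
            (((commutatorCenterHom hc t g ^ e * ψ g * φ g : Subgroup.center G)) : G) := by
          rw [hcen, zpow_add]
          push_cast
          simp only [mul_assoc]
      _ = _ := by
          congr 2
          simp only [MonoidHom.mul_apply, MonoidHom.zpow_apply]
          rw [mul_comm, mul_comm (commutatorCenterHom hc t g ^ e), mul_assoc]

/-- If a word map is nontrivial, then it takes a nontrivial value that becomes trivial once a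
single variable is replaced by `1`. -/
theorem FreeGroup.exists_lift_ne_one_and_lift_update_eq_one {G ι : Type*} [Group G] [Finite ι]
    [DecidableEq ι] {w : FreeGroup ι} {v : ι → G} (hv : FreeGroup.lift v w ≠ 1) :
    ∃ (v' : ι → G) (i : ι), FreeGroup.lift v' w ≠ 1 ∧
      FreeGroup.lift (Function.update v' i 1) w = 1 := by
  have := Fintype.ofFinite ι
  by_contra! hcon
  have h : ∀ s : Finset ι, FreeGroup.lift (fun j => if j ∈ s then 1 else v j) w ≠ 1 := by
    intro s
    induction s using Finset.induction_on with
    | empty => simpa using hv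
    | insert i s _ ih =>
      have h1 := hcon _ i ih
      convert h1 using 3
      ext j
      by_cases hj : j = i
      · subst hj
        simp
      · simp [hj]
  refine h Finset.univ ?_
  have h1 : FreeGroup.lift (fun _ : ι => (1 : G)) = 1 := by ext; simp
  simp [h1]

/-- Let `G` be a finite nonabelian `p`-group with a cyclic
maximal subgroup (a cyclic subgroup of index `p`), and let `Z` be a central
subgroup of `G` of order `p`. If `w` is a word with `G_w ⊆ Z` and
`G_w ≠ {1}`, then `G_w = Z`. -/
theorem image_eq_Z_of_nontrivial_image_in_Z
    {p : ℕ} (hp : p.Prime) {G : Type*} [Group G] [Finite G] (hG : IsPGroup p G)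
    (hnonab : ¬ ∀ x y : G, x * y = y * x)
    (A : Subgroup G) (hAcyc : IsCyclic ↥A) (hAindex : A.index = p)
    (Z : Subgroup G) (hZcentral : Z ≤ Subgroup.center G) (hZcard : Nat.card Z = p)
    (k : ℕ) (w : FreeGroup (Fin k))
    (hwZ : ∀ g : G, (∃ v : Fin k → G, (FreeGroup.lift v) w = g) → g ∈ Z)
    (hwnt : {g : G | ∃ v : Fin k → G, (FreeGroup.lift v) w = g} ≠ {1}) :
    {g : G | ∃ v : Fin k → G, (FreeGroup.lift v) w = g} = (Z : Set G) := by
  have := Fact.mk hp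
  have hw1 : FreeGroup.lift (fun _ : Fin k => (1 : G)) w = 1 := by
    have h1 : FreeGroup.lift (fun _ : Fin k => (1 : G)) = 1 := by ext; simp
    simp [h1]
  obtain ⟨v₀, hv₀⟩ : ∃ v : Fin k → G, FreeGroup.lift v w ≠ 1 := by
    by_contra! hcon
    refine hwnt (Set.eq_singleton_iff_unique_mem.mpr ⟨⟨_, hw1⟩, ?_⟩)
    rintro g ⟨v, rfl⟩
    exact hcon v
  obtain ⟨v, i, hv, hvi⟩ := FreeGroup.exists_lift_ne_one_and_lift_update_eq_one hv₀
  refine Set.Subset.antisymm (fun g hg => hwZ g hg) fun y hy => ?_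
  obtain ⟨m, hm⟩ : ∃ m : ℤ, FreeGroup.lift v w ^ m = y := by
    have h := mem_zpowers_of_prime_card (g := ⟨_, hwZ _ ⟨v, rfl⟩⟩) (g' := (⟨y, hy⟩ : Z)) hZcard
      (fun h => hv (congrArg Subtype.val h))
    obtain ⟨m, hm⟩ := Subgroup.mem_zpowers_iff.mp h
    exact ⟨m, by simpa using congrArg Subtype.val hm⟩
  rcases hp.eq_two_or_odd' with rfl | hodd
  · have hsq : FreeGroup.lift v w ^ (2 : ℤ) = 1 := by
      have h : (⟨_, hwZ _ ⟨v, rfl⟩⟩ : Z) ^ Nat.card Z = 1 := pow_card_eq_one'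
      rw [hZcard] at h
      simpa using congrArg Subtype.val h
    rcases Int.even_or_odd' m with ⟨n, rfl | rfl⟩
    · rw [zpow_mul, hsq, one_zpow] at hm
      exact ⟨_, hw1.trans hm⟩
    · rw [zpow_add, zpow_mul, hsq, one_zpow, one_mul, zpow_one] at hm
      exact ⟨v, hm⟩
  · have hc := hG.commutatorElement_mem_center_of_isCyclic_of_index_eq hp hodd A hAcyc hAindex
    obtain ⟨e, φ, hφ⟩ := FreeGroup.exists_lift_update_eq hc v i w
    simp only [hvi, one_mul] at hφ
    refine ⟨Function.update v i (v i ^ m), ?_⟩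
    have hvv := hφ (v i)
    rw [Function.update_eq_self] at hvv
    have hcom : Commute (v i ^ e) (φ (v i) : G) := Subgroup.mem_center_iff.mp (φ (v i)).2 _
    rw [hφ, ← hm, hvv, hcom.mul_zpow, map_zpow, Subgroup.coe_zpow, ← zpow_mul, ← zpow_mul,
      mul_comm m e]
end
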